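/- Let σ ≥ 2 be an integer and define g : ℝ → ℝ by g(λ) := (1 + |λ|^σ)^{−1}. Then: (i) g is (σ−1)-times continuously differentiable on ℝ; (ii) g(0) = 1; (iii) the ν-th derivative of g at 0 vanishes for every 1 ≤ ν ≤ σ − 1; and (iv) there is a constant C_σ > 0 such that |g^{(ν)}(λ)| ≤ C_σ·(1 + |λ|)^{−σ} for every λ ∈ ℝ and every 0 ≤ ν ≤ σ − 1. -/

import Mathlib

open Finset in
/-- The recursion for the derivatives of the reciprocal obtained from the Leibniz rule for
`f * f⁻¹ = 1`. -/
lemma mul_iteratedDeriv_succ_inv {f : ℝ → ℝ} {n : ℕ} (hf : ContDiff ℝ n f)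
    (hf0 : ∀ x, f x ≠ 0) {m : ℕ} (hm : m + 1 ≤ n) (x : ℝ) :
    f x * iteratedDeriv (m + 1) (fun y => (f y)⁻¹) x =
      -∑ i ∈ range (m + 1), ((m + 1).choose (i + 1) : ℝ) * iteratedDeriv (i + 1) f x *
        iteratedDeriv (m - i) (fun y => (f y)⁻¹) x := by
  have hfm : ContDiff ℝ (m + 1 : ℕ) f := hf.of_le (by exact_mod_cast hm)
  have key : iteratedDeriv (m + 1) (fun y => f y * (f y)⁻¹) x = 0 := by
    have : (fun y => f y * (f y)⁻¹) = fun _ => (1 : ℝ) :=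
      funext fun y => mul_inv_cancel₀ (hf0 y)
    rw [this, iteratedDeriv_const, if_neg m.succ_ne_zero]
  rw [iteratedDeriv_fun_mul (g := fun y => (f y)⁻¹) hfm.contDiffAt (hfm.inv hf0).contDiffAt,
    sum_range_succ'] at key
  simp only [Nat.choose_zero_right, Nat.cast_one, one_mul, iteratedDeriv_zero, Nat.sub_zero,
    Nat.add_sub_add_right] at key
  linarith

/-- If the derivatives of a positive function are dominated by the function itself, so are those
of its reciprocal. -/
lemma exists_abs_iteratedDeriv_inv_le {f : ℝ → ℝ} {n : ℕ} (hf : ContDiff ℝ n f)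
    (hf0 : ∀ x, 0 < f x) {K : ℝ} (hK : ∀ j, 1 ≤ j → j ≤ n → ∀ x, |iteratedDeriv j f x| ≤ K * f x) :
    ∃ C : ℝ, 0 < C ∧ ∀ j ≤ n, ∀ x, |iteratedDeriv j (fun y => (f y)⁻¹) x| ≤ C * (f x)⁻¹ := by
  suffices ∀ m ≤ n, ∃ C : ℝ, 0 < C ∧
      ∀ j ≤ m, ∀ x, |iteratedDeriv j (fun y => (f y)⁻¹) x| ≤ C * (f x)⁻¹ from this n le_rfl
  intro m
  induction m with
  | zero =>
    refine fun _ => ⟨1, one_pos, fun j hj x => ?_⟩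
    obtain rfl : j = 0 := by omega
    rw [iteratedDeriv_zero, one_mul, abs_of_pos (inv_pos.2 (hf0 x))]
  | succ m ih =>
    intro hm
    obtain ⟨C, hC, h⟩ := ih (by omega)
    set D := ∑ i ∈ Finset.range (m + 1), ((m + 1).choose (i + 1) : ℝ) * K * C
    refine ⟨max C D, lt_max_of_lt_left hC, fun j hj x => ?_⟩
    have hx := hf0 x
    rcases Nat.le_succ_iff.1 hj with hj | rfl
    · exact (h j hj x).trans (by gcongr; exact le_max_left _ _)
    · refine le_trans ?_ (mul_le_mul_of_nonneg_right (le_max_right C D) (inv_pos.2 hx).le)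
      rw [← div_eq_mul_inv, le_div_iff₀' hx]
      nth_rw 1 [← abs_of_pos hx]
      rw [← abs_mul,
        mul_iteratedDeriv_succ_inv hf (fun y => (hf0 y).ne') hm, abs_neg]
      refine (Finset.abs_sum_le_sum_abs _ _).trans (Finset.sum_le_sum fun i hi => ?_)
      have hi' := Finset.mem_range.1 hi
      rw [abs_mul, abs_mul, Nat.abs_cast, mul_assoc, mul_assoc]
      refine mul_le_mul_of_nonneg_left ?_ (Nat.cast_nonneg _)
      calc _ ≤ (K * f x) * (C * (f x)⁻¹) :=
            mul_le_mul (hK _ (by omega) (by omega) x) (h _ (by omega) x) (abs_nonneg _)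
              ((abs_nonneg _).trans (hK (i + 1) (by omega) (by omega) x))
        _ = K * C := by field_simp

/-- If the derivatives of `f` of orders `1, …, n` vanish at `x`, so do those of its reciprocal. -/
lemma iteratedDeriv_inv_eq_zero {f : ℝ → ℝ} {n : ℕ} (hf : ContDiff ℝ n f)
    (hf0 : ∀ y, f y ≠ 0) {x : ℝ} (h : ∀ j, 1 ≤ j → j ≤ n → iteratedDeriv j f x = 0)
    {j : ℕ} (hj : 1 ≤ j) (hjn : j ≤ n) : iteratedDeriv j (fun y => (f y)⁻¹) x = 0 := by
  obtain ⟨m, rfl⟩ := Nat.exists_eq_add_of_le' hj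
  refine (mul_eq_zero.1 ?_).resolve_left (hf0 x)
  rw [mul_iteratedDeriv_succ_inv hf hf0 hjn, neg_eq_zero]
  refine Finset.sum_eq_zero fun i hi => ?_
  rw [h _ (by omega) (by have := Finset.mem_range.1 hi; omega), mul_zero, zero_mul]

lemma hasDerivAt_pow_succ_mul_abs (k : ℕ) (x : ℝ) :
    HasDerivAt (fun y : ℝ => y ^ (k + 1) * |y|) ((k + 2) * (x ^ k * |x|)) x := by
  refine hasDerivAt_of_hasDerivAt_of_ne' (x := 0)
    (g := fun y : ℝ => ((k : ℝ) + 2) * (y ^ k * |y|)) (fun y hy => ?_)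
    (by fun_prop) (by fun_prop) x
  refine ((hasDerivAt_pow (k + 1) y).mul (hasDerivAt_abs hy)).congr_deriv ?_
  have : y * SignType.sign y = |y| := self_mul_sign y
  push_cast
  rw [pow_succ, mul_assoc (y ^ k) y, this]
  ring

/-- The functions `|x| ^ (k + 1)` are of the form `x ^ k * u x` with `u` either the identity or
the absolute value. -/
lemma exists_abs_pow_succ_eq (k : ℕ) : ∃ u : ℝ → ℝ, Continuous u ∧ (∀ x, |u x| = |x|) ∧
    (∀ x, |x| ^ (k + 1) = x ^ k * u x) ∧
    ∀ (m : ℕ) (x : ℝ), HasDerivAt (fun y => y ^ (m + 1) * u y) ((m + 2) * (x ^ m * u x)) x := by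
  rcases Nat.even_or_odd k with hk | hk
  · exact ⟨fun x => |x|, continuous_abs, abs_abs, fun x => by rw [pow_succ, hk.pow_abs],
      hasDerivAt_pow_succ_mul_abs⟩
  · refine ⟨id, continuous_id, fun _ => rfl, fun x => ?_, fun m x => ?_⟩
    · rw [hk.add_one.pow_abs, pow_succ, id]
    · refine ((hasDerivAt_pow (m + 1) x).mul (hasDerivAt_id x)).congr_deriv ?_
      push_cast
      simp only [id]
      ring

lemma contDiff_pow_mul {u : ℝ → ℝ} (hc : Continuous u)
    (hu : ∀ (m : ℕ) (x : ℝ), HasDerivAt (fun y => y ^ (m + 1) * u y) ((m + 2) * (x ^ m * u x)) x)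
    (k : ℕ) : ContDiff ℝ k fun x => x ^ k * u x := by
  induction k with
  | zero => simpa using hc
  | succ k ih =>
    push_cast
    refine contDiff_succ_iff_deriv.2 ⟨fun x => (hu k x).differentiableAt, by simp, ?_⟩
    rw [funext fun x => (hu k x).deriv]
    exact contDiff_const.mul ih

lemma exists_iteratedDeriv_pow_mul {u : ℝ → ℝ} (hc : Continuous u)
    (hu : ∀ (m : ℕ) (x : ℝ), HasDerivAt (fun y => y ^ (m + 1) * u y) ((m + 2) * (x ^ m * u x)) x)
    (j m : ℕ) :
    ∃ c : ℝ, ∀ x, iteratedDeriv j (fun y => y ^ (m + j) * u y) x = c * (x ^ m * u x) := by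
  induction j with
  | zero => exact ⟨1, by simp⟩
  | succ j ih =>
    obtain ⟨c, h⟩ := ih
    refine ⟨((m + j : ℕ) + 2) * c, fun x => ?_⟩
    rw [iteratedDeriv_succ', ← add_assoc, funext fun y => (hu (m + j) y).deriv,
      iteratedDeriv_const_mul _ (((contDiff_pow_mul hc hu (m + j)).of_le
        (by exact_mod_cast Nat.le_add_left j m)).contDiffAt), h, mul_assoc]

lemma contDiff_abs_pow_succ (k : ℕ) : ContDiff ℝ k fun x : ℝ => |x| ^ (k + 1) := by
  obtain ⟨u, hc, -, hpow, hu⟩ := exists_abs_pow_succ_eq k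
  simpa only [hpow] using contDiff_pow_mul hc hu k

lemma exists_abs_iteratedDeriv_abs_pow_succ (k : ℕ) {j : ℕ} (hj : j ≤ k) :
    ∃ c : ℝ, 0 ≤ c ∧
      ∀ x, |iteratedDeriv j (fun y : ℝ => |y| ^ (k + 1)) x| = c * |x| ^ (k + 1 - j) := by
  obtain ⟨u, hc, habs, hpow, hu⟩ := exists_abs_pow_succ_eq k
  obtain ⟨m, rfl⟩ := Nat.exists_eq_add_of_le' hj
  obtain ⟨c, h⟩ := exists_iteratedDeriv_pow_mul hc hu j m
  refine ⟨|c|, abs_nonneg c, fun x => ?_⟩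
  rw [funext hpow, h, abs_mul, abs_mul, habs, abs_pow, ← pow_succ]
  congr 2
  omega

lemma exists_abs_iteratedDeriv_one_add_abs_pow_succ_le (k : ℕ) : ∃ K : ℝ, ∀ j, 1 ≤ j → j ≤ k →
    ∀ x, |iteratedDeriv j (fun y : ℝ => 1 + |y| ^ (k + 1)) x| ≤ K * (1 + |x| ^ (k + 1)) := by
  choose! c hc h using fun j (hj : j ≤ k) => exists_abs_iteratedDeriv_abs_pow_succ k hj
  refine ⟨∑ j ∈ Finset.range (k + 1), c j, fun j hj hjk x => ?_⟩
  rw [iteratedDeriv_const_add hj, h j hjk]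
  refine mul_le_mul (Finset.single_le_sum (f := c) (fun i hi => hc i ?_) ?_) ?_ (by positivity)
    (Finset.sum_nonneg fun i hi => hc i ?_)
  · exact Nat.lt_succ_iff.1 (Finset.mem_range.1 hi)
  · exact Finset.mem_range.2 (by omega)
  · rcases le_total |x| 1 with hx | hx
    · exact (pow_le_one₀ (abs_nonneg x) hx).trans (le_add_of_nonneg_right (by positivity))
    · exact (pow_le_pow_right₀ hx (Nat.sub_le _ _)).trans (le_add_of_nonneg_left zero_le_one)
  · exact Nat.lt_succ_iff.1 (Finset.mem_range.1 hi)

lemma inv_one_add_abs_pow_le (k : ℕ) (x : ℝ) :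
    (1 + |x| ^ (k + 1))⁻¹ ≤ 2 ^ k * (1 + |x|) ^ (-((k + 1 : ℕ) : ℝ)) := by
  have h := add_pow_le zero_le_one (abs_nonneg x) (k + 1)
  rw [one_pow, Nat.add_sub_cancel] at h
  rw [Real.rpow_neg (by positivity), Real.rpow_natCast, ← div_eq_mul_inv, inv_eq_one_div,
    div_le_div_iff₀ (by positivity) (by positivity), one_mul]
  exact h

/-- For an integer `σ ≥ 2`, the function `g(λ) = (1 + |λ|^σ)⁻¹` is
`(σ−1)`-times continuously differentiable, `g(0) = 1`, `g^{(ν)}(0) = 0` for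
`1 ≤ ν ≤ σ−1`, and there is `C_σ > 0` with `|g^{(ν)}(λ)| ≤ C_σ (1 + |λ|)^{−σ}` for every
`λ ∈ ℝ` and `0 ≤ ν ≤ σ−1`. -/
theorem stmt14 (σ : ℕ) (hσ : 2 ≤ σ) (g : ℝ → ℝ)
    (hg : ∀ l : ℝ, g l = (1 + |l| ^ σ)⁻¹) :
    ContDiff ℝ ((σ - 1 : ℕ) : ℕ∞) g ∧
    g 0 = 1 ∧
    (∀ ν : ℕ, 1 ≤ ν → ν ≤ σ - 1 → iteratedDeriv ν g 0 = 0) ∧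
    ∃ C : ℝ, 0 < C ∧ ∀ (l : ℝ) (ν : ℕ), ν ≤ σ - 1 →
      |iteratedDeriv ν g l| ≤ C * (1 + |l|) ^ (-(σ : ℝ)) := by
  obtain ⟨k, rfl⟩ : ∃ k, σ = k + 1 := ⟨σ - 1, by omega⟩
  rw [Nat.add_sub_cancel]
  obtain rfl : g = fun l => (1 + |l| ^ (k + 1))⁻¹ := funext hg
  have hf : ContDiff ℝ k fun x : ℝ => 1 + |x| ^ (k + 1) :=
    contDiff_const.add (contDiff_abs_pow_succ k)
  have hf0 : ∀ x : ℝ, 0 < 1 + |x| ^ (k + 1) := fun x => by positivity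
  refine ⟨hf.inv fun x => (hf0 x).ne', by simp, fun ν hν hνk => ?_, ?_⟩
  · refine iteratedDeriv_inv_eq_zero hf (fun x => (hf0 x).ne') (fun j hj hjk => ?_) hν hνk
    obtain ⟨c, -, h⟩ := exists_abs_iteratedDeriv_abs_pow_succ k hjk
    rw [iteratedDeriv_const_add hj, ← abs_eq_zero, h, abs_zero, zero_pow (by omega), mul_zero]
  · obtain ⟨K, hK⟩ := exists_abs_iteratedDeriv_one_add_abs_pow_succ_le k
    obtain ⟨C, hC, h⟩ := exists_abs_iteratedDeriv_inv_le hf hf0 hK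
    refine ⟨C * 2 ^ k, by positivity, fun l ν hν => (h ν hν l).trans ?_⟩
    rw [mul_assoc]
    exact mul_le_mul_of_nonneg_left (inv_one_add_abs_pow_le k l) hC.le
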